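/- arXiv:2601.00199 — 2 statements merged into one kernel-verified Lean document; each statement's English description precedes it below -/
import Mathlib

section
/- Let Y ∈ ℝ^{m×n}, let G := Y·Yᵀ (a real symmetric positive semidefinite m×m matrix), let μ_1 ≥ μ_2 ≥ ⋯ ≥ μ_m be the eigenvalues of G listed in nonincreasing order with multiplicity, and let u_1,…,u_m ∈ ℝ^m be a corresponding orthonormal basis of eigenvectors. For 0 ≤ k ≤ m, let Φ ∈ ℝ^{m×k} be the matrix whose columns are u_1,…,u_k. Then ‖Y − Φ·Φᵀ·Y‖_F² = Σ_{j=k+1}^{m} μ_j. -/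
open Matrix

/-- The Gram matrix of an orthonormal family `w` is the identity. -/
theorem Matrix.of_mul_transpose_of_orthonormal {ι κ : Type*} [Fintype ι] [DecidableEq κ]
    (w : κ → ι → ℝ) (hw : ∀ i j, w i ⬝ᵥ w j = if i = j then (1 : ℝ) else 0) :
    (Matrix.of w) * (Matrix.of w)ᵀ = 1 := by
  ext i j
  rw [Matrix.mul_apply, Matrix.one_apply]
  exact hw i j

/-- The trace of the compression of `G` to unit eigenvectors is the sum of their eigenvalues. -/
theorem Matrix.trace_compression_of_eigenvectors {ι κ : Type*} [Fintype ι] [Fintype κ]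
    (G : Matrix ι ι ℝ) (w : κ → ι → ℝ) (ν : κ → ℝ) (hw : ∀ j, w j ⬝ᵥ w j = 1)
    (hG : ∀ j, G.mulVec (w j) = ν j • w j) :
    (Matrix.of w * (G * (Matrix.of w)ᵀ)).trace = ∑ j, ν j := by
  refine Finset.sum_congr rfl fun j _ => ?_
  have h : (Matrix.of w * (G * (Matrix.of w)ᵀ)) j j = w j ⬝ᵥ G.mulVec (w j) := rfl
  rw [Matrix.diag_apply, h, hG, dotProduct_smul, hw, smul_eq_mul, mul_one]

/-- The squared Frobenius distance from `Y` to its projection onto the column span of a matrix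
`Φ` with orthonormal columns. -/
theorem Matrix.sum_sq_sub_proj {ι κ l : Type*} [Fintype ι] [Fintype κ] [Fintype l]
    [DecidableEq κ] (Y : Matrix ι l ℝ) (Φ : Matrix ι κ ℝ) (hΦ : Φᵀ * Φ = 1) :
    ∑ i, ∑ j, ((Y - Φ * Φᵀ * Y) i j) ^ 2
      = (Y * Yᵀ).trace - (Φᵀ * (Y * Yᵀ * Φ)).trace := by
  have hfrob : ∑ i, ∑ j, ((Y - Φ * Φᵀ * Y) i j) ^ 2
      = ((Y - Φ * Φᵀ * Y) * (Y - Φ * Φᵀ * Y)ᵀ).trace := by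
    simp only [Matrix.trace, Matrix.diag_apply, Matrix.mul_apply, Matrix.transpose_apply, sq]
  have hP : Φᵀ * (Φ * (Φᵀ * Y)) = Φᵀ * Y := by
    rw [← Matrix.mul_assoc, hΦ, Matrix.one_mul]
  have horth : (Φ * Φᵀ * Y)ᵀ * (Y - Φ * Φᵀ * Y) = 0 := by
    simp only [Matrix.transpose_mul, Matrix.transpose_transpose, Matrix.mul_sub,
      Matrix.mul_assoc, hP, sub_self]
  rw [hfrob, Matrix.trace_mul_comm, Matrix.transpose_sub, Matrix.sub_mul, horth, sub_zero,
    Matrix.mul_sub, Matrix.trace_sub, Matrix.trace_mul_comm]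
  congr 1
  rw [Matrix.trace_mul_comm, Matrix.mul_assoc, Matrix.mul_assoc, Matrix.trace_mul_comm]
  simp only [Matrix.mul_assoc]

/-- POD truncation error identity on the snapshot set (Eckart–Young–Mirsky):
if `u₁,…,u_m` is an orthonormal basis of eigenvectors of `G = Y·Yᵀ` with
eigenvalues `μ₁ ≥ ⋯ ≥ μ_m` (listed nonincreasingly with multiplicity) and `Φ`
is the matrix with columns `u₁,…,u_k` (`0 ≤ k ≤ m`), then
`‖Y − Φ·Φᵀ·Y‖_F² = Σ_{j>k} μ_j`. -/
theorem stmt2 (m n : ℕ) (Y : Matrix (Fin m) (Fin n) ℝ)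
    (μ : Fin m → ℝ) (u : Fin m → (Fin m → ℝ))
    (hsort : Antitone μ)
    (hortho : ∀ i j : Fin m, u i ⬝ᵥ u j = if i = j then (1 : ℝ) else 0)
    (heig : ∀ i : Fin m, (Y * Yᵀ).mulVec (u i) = μ i • u i)
    (k : ℕ) (hk : k ≤ m)
    (Φ : Matrix (Fin m) (Fin k) ℝ)
    (hΦ : Φ = Matrix.of fun i j => u (Fin.castLE hk j) i) :
    ∑ i, ∑ j, ((Y - Φ * Φᵀ * Y) i j) ^ 2
      = ∑ j ∈ Finset.univ.filter (fun j : Fin m => k ≤ (j : ℕ)), μ j := by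
  obtain ⟨l, rfl⟩ := Nat.exists_eq_add_of_le hk
  set w : Fin k → Fin (k + l) → ℝ := fun j => u (Fin.castLE hk j) with hw
  have hΦw : Φ = (Matrix.of w)ᵀ := hΦ
  have hworth : ∀ i j, w i ⬝ᵥ w j = if i = j then (1 : ℝ) else 0 := fun i j => by
    simp [hw, hortho]
  have hΦΦ : Φᵀ * Φ = 1 := by
    rw [hΦw, Matrix.transpose_transpose]
    exact Matrix.of_mul_transpose_of_orthonormal w hworth
  have htrΦ : (Φᵀ * (Y * Yᵀ * Φ)).trace = ∑ j, μ (Fin.castLE hk j) := by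
    rw [hΦw, Matrix.transpose_transpose]
    exact Matrix.trace_compression_of_eigenvectors _ w _ (fun j => by simp [hworth])
      fun j => heig _
  have hU : (Matrix.of u)ᵀ * Matrix.of u = 1 :=
    mul_eq_one_comm.mp (Matrix.of_mul_transpose_of_orthonormal u hortho)
  have htr : (Y * Yᵀ).trace = ∑ j, μ j := by
    rw [← Matrix.trace_compression_of_eigenvectors (Y * Yᵀ) u μ (fun j => by simp [hortho]) heig,
      Matrix.trace_mul_comm (Matrix.of u), Matrix.mul_assoc _ _ (Matrix.of u), hU, Matrix.mul_one]
  rw [Matrix.sum_sq_sub_proj Y Φ hΦΦ, htr, htrΦ, Finset.sum_filter, Fin.sum_univ_add,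
    Fin.sum_univ_add]
  have hlow : ∀ j : Fin k, ¬ k ≤ (j : ℕ) := fun j => not_le.mpr j.isLt
  have hcast : ∀ j : Fin k, Fin.castLE hk j = Fin.castAdd l j := fun _ => rfl
  simp [hlow, hcast]
end

section
/- Let A, B ∈ ℂ^{n×n} be Hermitian matrices, and let λ_1(A) ≤ λ_2(A) ≤ ⋯ ≤ λ_n(A) and λ_1(B) ≤ ⋯ ≤ λ_n(B) denote their eigenvalues listed in nondecreasing order with multiplicity. Then Σ_{i=1}^{n} (λ_i(A) − λ_i(B))² ≤ ‖A − B‖_F² (the Hoffman–Wielandt inequality for Hermitian matrices). -/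
open Matrix

/-- The eigenvalues of a Hermitian matrix, listed in nondecreasing order with
multiplicity: the `i`-th entry is the `i`-th smallest eigenvalue. -/
noncomputable def sortedEigs {n : ℕ} {A : Matrix (Fin n) (Fin n) ℂ}
    (hA : A.IsHermitian) : Fin n → ℝ :=
  hA.eigenvalues ∘ Tuple.sort hA.eigenvalues

/-- The squared distance to a rearrangement is smallest when the families vary together. -/
theorem Monovary.sum_sub_sq_le_sum_sub_comp_perm_sq {ι : Type*} [Fintype ι] {f g : ι → ℝ}
    (hfg : Monovary f g) (σ : Equiv.Perm ι) :
    ∑ i, (f i - g i) ^ 2 ≤ ∑ i, (f i - g (σ i)) ^ 2 := by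
  have h := hfg.sum_mul_comp_perm_le_sum_mul (σ := σ)
  have hg : ∑ i, g (σ i) ^ 2 = ∑ i, g i ^ 2 := Equiv.sum_comp σ fun i => g i ^ 2
  simp only [sub_sq, Finset.sum_add_distrib, Finset.sum_sub_distrib, mul_assoc,
    ← Finset.mul_sum, hg]
  linarith

/-- Sorting both families minimizes their squared distance over all matchings. -/
theorem sum_sort_sub_sort_sq_le {n : ℕ} (f g : Fin n → ℝ) (σ : Equiv.Perm (Fin n)) :
    ∑ i, ((f ∘ Tuple.sort f) i - (g ∘ Tuple.sort g) i) ^ 2 ≤ ∑ i, (f i - g (σ i)) ^ 2 := by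
  have h := ((Tuple.monotone_sort f).monovary
    (Tuple.monotone_sort g)).sum_sub_sq_le_sum_sub_comp_perm_sq
      (((Tuple.sort f).trans σ).trans (Tuple.sort g).symm)
  refine h.trans_eq ?_
  simpa using Equiv.sum_comp (Tuple.sort f) fun i => (f i - g (σ i)) ^ 2

/-- A linear cost over doubly stochastic matrices is bounded below by any lower bound valid at
all permutation matrices. -/
theorem le_sum_mul_of_mem_doublyStochastic {ι : Type*} [Fintype ι] [DecidableEq ι]
    {S c : Matrix ι ι ℝ} {m : ℝ} (hS : S ∈ doublyStochastic ℝ ι)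
    (h : ∀ σ : Equiv.Perm ι, m ≤ ∑ i, c i (σ i)) : m ≤ ∑ i, ∑ j, c i j * S i j := by
  obtain ⟨w, hw, hw1, rfl⟩ := exists_eq_sum_perm_of_mem_doublyStochastic hS
  calc m = ∑ σ, w σ * m := by rw [← Finset.sum_mul, hw1, one_mul]
    _ ≤ ∑ σ, w σ * ∑ i, c i (σ i) :=
      Finset.sum_le_sum fun σ _ => mul_le_mul_of_nonneg_left (h σ) (hw σ)
    _ = ∑ σ, ∑ i, ∑ j, c i j * (w σ * σ.permMatrix ℝ i j) := by
      refine Finset.sum_congr rfl fun σ _ => ?_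
      rw [Finset.mul_sum]
      refine Finset.sum_congr rfl fun i _ => ?_
      simp [Equiv.Perm.permMatrix, PEquiv.toMatrix_apply, mul_comm]
    _ = _ := by
      simp only [Matrix.sum_apply, Matrix.smul_apply, smul_eq_mul, Finset.mul_sum]
      rw [Finset.sum_comm]
      exact Finset.sum_congr rfl fun i _ => Finset.sum_comm

namespace Matrix

variable {𝕜 ι : Type*} [RCLike 𝕜] [Fintype ι]

/-- The trace of `Mᴴ * M` is the squared Frobenius norm of `M`. -/
theorem trace_conjTranspose_mul_self_eq_sum_norm_sq (M : Matrix ι ι 𝕜) :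
    (Mᴴ * M).trace = ((∑ i, ∑ j, ‖M i j‖ ^ 2 : ℝ) : 𝕜) := by
  rw [Finset.sum_comm]
  simp [trace, mul_apply, RCLike.conj_mul]

variable [DecidableEq ι]

/-- The Frobenius norm is invariant under multiplication by unitaries on both sides. -/
theorem sum_norm_sq_unitary_mul_mul_unitary {U V : Matrix ι ι 𝕜} (hU : U ∈ unitaryGroup ι 𝕜)
    (hV : V ∈ unitaryGroup ι 𝕜) (M : Matrix ι ι 𝕜) :
    ∑ i, ∑ j, ‖(U * M * V) i j‖ ^ 2 = ∑ i, ∑ j, ‖M i j‖ ^ 2 := by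
  have hU' : Uᴴ * U = 1 := mem_unitaryGroup_iff'.mp hU
  have hV' : V * Vᴴ = 1 := mem_unitaryGroup_iff.mp hV
  apply RCLike.ofReal_injective (K := 𝕜)
  rw [← trace_conjTranspose_mul_self_eq_sum_norm_sq, ← trace_conjTranspose_mul_self_eq_sum_norm_sq]
  calc ((U * M * V)ᴴ * (U * M * V)).trace = (Vᴴ * (Mᴴ * (Uᴴ * U) * M) * V).trace := by
        simp only [conjTranspose_mul, Matrix.mul_assoc]
    _ = (Mᴴ * M).trace := by
        rw [hU', Matrix.mul_one, trace_mul_comm, ← Matrix.mul_assoc, hV', Matrix.one_mul]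

/-- The squared absolute values of the entries of a unitary form a doubly stochastic matrix. -/
theorem norm_sq_mem_doublyStochastic {W : Matrix ι ι 𝕜} (hW : W ∈ unitaryGroup ι 𝕜) :
    (of fun i j => ‖W i j‖ ^ 2) ∈ doublyStochastic ℝ ι := by
  refine mem_doublyStochastic_iff_sum.mpr ⟨fun i j => sq_nonneg _, fun i => ?_, fun j => ?_⟩
  · apply RCLike.ofReal_injective (K := 𝕜)
    simpa [mul_apply, RCLike.mul_conj] using congr_fun₂ (mem_unitaryGroup_iff.mp hW) i i
  · apply RCLike.ofReal_injective (K := 𝕜)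
    simpa [mul_apply, RCLike.conj_mul] using congr_fun₂ (mem_unitaryGroup_iff'.mp hW) j j

/-- The squared Frobenius distance of two Hermitian matrices in terms of their eigenvalues and the
unitary relating their eigenbases. -/
theorem IsHermitian.sum_norm_sub_sq {A B : Matrix ι ι 𝕜} (hA : A.IsHermitian)
    (hB : B.IsHermitian) :
    ∑ i, ∑ j, ‖(A - B) i j‖ ^ 2 = ∑ i, ∑ j, (hA.eigenvalues i - hB.eigenvalues j) ^ 2 *
      ‖(star (hA.eigenvectorUnitary : Matrix ι ι 𝕜) *
        (hB.eigenvectorUnitary : Matrix ι ι 𝕜)) i j‖ ^ 2 := by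
  rw [← sum_norm_sq_unitary_mul_mul_unitary (star hA.eigenvectorUnitary).2
    hB.eigenvectorUnitary.2, Unitary.coe_star]
  have h1 : star (hA.eigenvectorUnitary : Matrix ι ι 𝕜) * A =
      diagonal (RCLike.ofReal ∘ hA.eigenvalues) *
        star (hA.eigenvectorUnitary : Matrix ι ι 𝕜) := by
    conv_lhs => enter [2]; rw [hA.spectral_theorem, Unitary.conjStarAlgAut_apply]
    rw [← Matrix.mul_assoc, ← Matrix.mul_assoc, Unitary.coe_star_mul_self, Matrix.one_mul]
  have h2 : B * (hB.eigenvectorUnitary : Matrix ι ι 𝕜) =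
      (hB.eigenvectorUnitary : Matrix ι ι 𝕜) * diagonal (RCLike.ofReal ∘ hB.eigenvalues) := by
    conv_lhs => enter [1]; rw [hB.spectral_theorem, Unitary.conjStarAlgAut_apply]
    rw [Matrix.mul_assoc, Unitary.coe_star_mul_self, Matrix.mul_one]
  rw [Matrix.mul_sub, Matrix.sub_mul, h1, Matrix.mul_assoc _ B, h2, Matrix.mul_assoc,
    ← Matrix.mul_assoc _ _ (diagonal _)]
  refine Finset.sum_congr rfl fun i _ => Finset.sum_congr rfl fun j _ => ?_
  rw [sub_apply, diagonal_mul, mul_diagonal, Function.comp_apply, Function.comp_apply,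
    mul_comm _ (RCLike.ofReal (hB.eigenvalues j)), ← sub_mul, ← RCLike.ofReal_sub,
    norm_mul, mul_pow, RCLike.norm_ofReal, sq_abs]

end Matrix

/-- Hoffman–Wielandt inequality for Hermitian matrices: if `λ_i(A)` and
`λ_i(B)` denote the eigenvalues of Hermitian `A, B` listed in nondecreasing
order with multiplicity, then `Σ_i (λ_i(A) − λ_i(B))² ≤ ‖A − B‖_F²`. -/
theorem stmt4 (n : ℕ) (A B : Matrix (Fin n) (Fin n) ℂ)
    (hA : A.IsHermitian) (hB : B.IsHermitian) :
    ∑ i, (sortedEigs hA i - sortedEigs hB i) ^ 2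
      ≤ ∑ i, ∑ j, ‖(A - B) i j‖ ^ 2 := by
  rw [hA.sum_norm_sub_sq hB]
  have hS := norm_sq_mem_doublyStochastic
    (star hA.eigenvectorUnitary * hB.eigenvectorUnitary).2
  have h := le_sum_mul_of_mem_doublyStochastic
    (c := of fun i j => (hA.eigenvalues i - hB.eigenvalues j) ^ 2) hS
    (sum_sort_sub_sort_sq_le hA.eigenvalues hB.eigenvalues)
  simpa only [of_apply, sortedEigs, Submonoid.coe_mul, Unitary.coe_star] using h
end
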